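/- arXiv:2604.03930 — 2 statements merged into one kernel-verified Lean document; each statement's English description precedes it below -/
import Mathlib

section
/- Let k be an algebraically closed field, g ≥ 0 an integer, and c⃗ = (c₁,…,c_m) a vector of EVEN positive integers with sum c satisfying g + m − 1 < c ≤ 2(g + m − 1). Then there exists a k-subalgebra B ⊆ A⁺_{c⃗} of corank g such that for every i ∈ {1,…,m}, the element tᵢ^{cᵢ−1} does not belong to B (i.e., B corresponds to a reduced curve singularity of genus g with branch conductances exactly c⃗). -/
set_option synthInstance.maxHeartbeats 1000000
set_option maxHeartbeats 2000000
open Polynomial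

/-- The truncated polynomial ring `k[X]/(X^c)`. -/
abbrev TruncP (k : Type*) [CommRing k] (c : ℕ) : Type _ :=
  Polynomial k ⧸ Ideal.span {(X : Polynomial k) ^ c}

/-- The ambient product algebra `∏ i, k[tᵢ]/(tᵢ^{cᵢ})`. -/
abbrev TruncPi (k : Type*) [CommRing k] {ι : Type*} (c : ι → ℕ) : Type _ :=
  ∀ i, TruncP k (c i)

/-- The image of `X` in `TruncP k c`. -/
noncomputable def truncX (k : Type*) [CommRing k] (c : ℕ) : TruncP k c :=
  Ideal.Quotient.mk _ X

/-- The monomial `tᵢ^j` in `∏ i, k[tᵢ]/(tᵢ^{cᵢ})`. -/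
noncomputable def tpow {k : Type*} [CommRing k] {ι : Type*} [DecidableEq ι]
    (c : ι → ℕ) (i : ι) (j : ℕ) : TruncPi k c :=
  Pi.single i (truncX k (c i) ^ j)

/-- The constant term of a truncated polynomial (evaluation at `0`), for `c ≥ 1`. -/
noncomputable def constTerm (k : Type*) [CommRing k] (c : ℕ) (hc : 1 ≤ c) :
    TruncP k c →ₐ[k] k :=
  Ideal.Quotient.liftₐ _ (aeval (0 : k)) (by
    intro a ha
    rw [Ideal.mem_span_singleton] at ha
    obtain ⟨q, rfl⟩ := ha
    have h0 : (0 : k) ^ c = 0 := zero_pow (Nat.one_le_iff_ne_zero.mp hc)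
    simp [h0])

/-- `A⁺`: the subalgebra of tuples with all constant terms equal. -/
noncomputable def Aplus (k : Type*) [CommRing k] {ι : Type*} (c : ι → ℕ)
    (hc : ∀ i, 1 ≤ c i) : Subalgebra k (TruncPi k c) :=
  ⨅ (i : ι) (j : ι),
    AlgHom.equalizer
      ((constTerm k (c i) (hc i)).comp (Pi.evalAlgHom k (fun i => TruncP k (c i)) i))
      ((constTerm k (c j) (hc j)).comp (Pi.evalAlgHom k (fun i => TruncP k (c i)) j))

/-- `m_I`: the span of the monomials `tᵢ^j`, `i ∈ I`, `1 ≤ j ≤ cᵢ - 1`. -/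
noncomputable def mPart (k : Type*) [CommRing k] {ι : Type*} [DecidableEq ι]
    (c : ι → ℕ) (I : Set ι) : Submodule k (TruncPi k c) :=
  Submodule.span k {x | ∃ i ∈ I, ∃ j, 1 ≤ j ∧ j < c i ∧ x = tpow c i j}

/-- `𝔪^d`: the span of the monomials of degree at least `d`. -/
noncomputable def mPow (k : Type*) [CommRing k] {ι : Type*} [DecidableEq ι]
    (c : ι → ℕ) (d : ℕ) : Submodule k (TruncPi k c) :=
  Submodule.span k {x | ∃ i, ∃ j, d ≤ j ∧ 1 ≤ j ∧ j < c i ∧ x = tpow c i j}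

/-- Componentwise projection onto the coordinates in `I` (the projection along `m_{Iᶜ}`). -/
noncomputable def projL (k : Type*) [CommRing k] {ι : Type*} [DecidableEq ι] (c : ι → ℕ)
    (I : Finset ι) : TruncPi k c →ₗ[k] TruncPi k c where
  toFun x i := if i ∈ I then x i else 0
  map_add' x y := by funext i; by_cases h : i ∈ I <;> simp [h]
  map_smul' r x := by funext i; by_cases h : i ∈ I <;> simp [h]

/-- Scaling `t ↦ λ·t` on `k[t]/(t^c)`, as a `k`-algebra homomorphism. -/
noncomputable def scaleHom (k : Type*) [CommRing k] (c : ℕ) (lam : k) :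
    TruncP k c →ₐ[k] TruncP k c :=
  Ideal.Quotient.liftₐ _ (aeval (lam • truncX k c)) (by
    intro a ha
    rw [Ideal.mem_span_singleton] at ha
    obtain ⟨q, rfl⟩ := ha
    have hx : truncX k c ^ c = 0 := by
      show (Ideal.Quotient.mk (Ideal.span {(X : Polynomial k) ^ c}) X) ^ c = 0
      rw [← map_pow, Ideal.Quotient.eq_zero_iff_mem]
      exact Ideal.mem_span_singleton_self _
    simp [_root_.smul_pow, hx])

/-- The torus action `tᵢ ↦ λᵢ·tᵢ` on `∏ i, k[tᵢ]/(tᵢ^{cᵢ})`. -/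
noncomputable def torusHom {k : Type*} [CommRing k] {ι : Type*} (c : ι → ℕ) (lam : ι → k) :
    TruncPi k c →ₐ[k] TruncPi k c :=
  Pi.algHom k _ fun i => (scaleHom k (c i) (lam i)).comp (Pi.evalAlgHom k _ i)

/-- Restriction of a tuple to the coordinates satisfying `P`, as an algebra hom. -/
noncomputable def restrictAlg (k : Type*) [CommRing k] {ι : Type*} (c : ι → ℕ)
    (P : ι → Prop) : TruncPi k c →ₐ[k] TruncPi k (fun i : {i // P i} => c i.1) where
  toFun x i := x i.1
  map_one' := rfl
  map_mul' _ _ := rfl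
  map_zero' := rfl
  map_add' _ _ := rfl
  commutes' _ := rfl

/-- The set `k·1 ⊕ {b + b' + φ(b')}` associated to a gluing datum. -/
def graphSet {k A : Type*} [CommRing k] [CommRing A] [Algebra k A]
    (bI bI' : Submodule k A) (φ : ↥bI' →ₗ[k] A) : Set A :=
  {z | ∃ r : k, ∃ b ∈ bI, ∃ b' : ↥bI', z = r • (1 : A) + b + ↑b' + φ b'}

section TruncatedCoefficients

variable {k : Type*} [Field k]

/-- The coefficient of `X ^ j` in a truncated polynomial. -/
noncomputable def truncCoeff (k : Type*) [Field k] (c j : ℕ) : TruncP k c →ₗ[k] k :=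
  (lcoeff k j).comp (AdjoinRoot.modByMonicHom (monic_X_pow (R := k) c))

theorem truncCoeff_mk {c j : ℕ} (hj : j < c) (p : k[X]) :
    truncCoeff k c j (Ideal.Quotient.mk _ p) = p.coeff j := by
  have h : truncCoeff k c j (Ideal.Quotient.mk _ p) = (p %ₘ X ^ c).coeff j := rfl
  rw [h]
  conv_rhs => rw [← modByMonic_add_div p (X ^ c : k[X])]
  rw [coeff_add, coeff_X_pow_mul', if_neg (by lia), add_zero]

theorem truncCoeff_mul {c j : ℕ} (hj : j < c) (x y : TruncP k c) :
    truncCoeff k c j (x * y) =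
      ∑ p ∈ Finset.HasAntidiagonal.antidiagonal j, truncCoeff k c p.1 x * truncCoeff k c p.2 y := by
  obtain ⟨p, rfl⟩ := Ideal.Quotient.mk_surjective x
  obtain ⟨q, rfl⟩ := Ideal.Quotient.mk_surjective y
  rw [← map_mul, truncCoeff_mk hj, coeff_mul]
  refine Finset.sum_congr rfl fun a ha => ?_
  rw [Finset.HasAntidiagonal.mem_antidiagonal] at ha
  rw [truncCoeff_mk (by lia), truncCoeff_mk (by lia)]

theorem truncCoeff_truncX_pow {c j : ℕ} (hj : j < c) (n : ℕ) :
    truncCoeff k c j (truncX k c ^ n) = if j = n then 1 else 0 := by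
  rw [truncX, ← map_pow, truncCoeff_mk hj, coeff_X_pow]

theorem constTerm_eq_truncCoeff {c : ℕ} (hc : 1 ≤ c) (x : TruncP k c) :
    constTerm k c hc x = truncCoeff k c 0 x := by
  obtain ⟨p, rfl⟩ := Ideal.Quotient.mk_surjective x
  rw [truncCoeff_mk (by lia)]
  change aeval (0 : k) p = _
  rw [coeff_zero_eq_aeval_zero]

theorem isNilpotent_of_constTerm_eq_zero {c : ℕ} (hc : 1 ≤ c) {x : TruncP k c}
    (hx : constTerm k c hc x = 0) : IsNilpotent x := by
  rw [constTerm_eq_truncCoeff] at hx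
  obtain ⟨p, rfl⟩ := Ideal.Quotient.mk_surjective x
  rw [truncCoeff_mk (by lia)] at hx
  refine ⟨c, ?_⟩
  rw [← map_pow, Ideal.Quotient.eq_zero_iff_mem, Ideal.mem_span_singleton]
  exact pow_dvd_pow_of_dvd (X_dvd_iff.mpr hx) c

theorem finrank_truncP (c : ℕ) : Module.finrank k (TruncP k c) = c := by
  rw [finrank_quotient_span_eq_natDegree, natDegree_X_pow]

theorem finite_truncP (c : ℕ) : Module.Finite k (TruncP k c) :=
  (AdjoinRoot.powerBasis' (monic_X_pow (R := k) c)).finite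

end TruncatedCoefficients

section UnitalHull

variable {k A : Type*} [Field k] [CommRing A] [Algebra k A]

/-- The subalgebra `k·1 + V` attached to a subspace `V` closed under multiplication. -/
def unitalHull (V : Submodule k A) (hV : V * V ≤ V) : Subalgebra k A where
  carrier := {x | ∃ r : k, ∃ v ∈ V, x = algebraMap k A r + v}
  mul_mem' := by
    rintro _ _ ⟨r, v, hv, rfl⟩ ⟨s, w, hw, rfl⟩
    refine ⟨r * s, r • w + s • v + v * w, V.add_mem (V.add_mem (V.smul_mem _ hw)
      (V.smul_mem _ hv)) (hV (Submodule.mul_mem_mul hv hw)), ?_⟩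
    rw [map_mul, Algebra.smul_def, Algebra.smul_def]
    ring
  add_mem' := by
    rintro _ _ ⟨r, v, hv, rfl⟩ ⟨s, w, hw, rfl⟩
    exact ⟨r + s, v + w, V.add_mem hv hw, by rw [map_add]; ring⟩
  algebraMap_mem' r := ⟨r, 0, V.zero_mem, by simp⟩

theorem mem_unitalHull {V : Submodule k A} {hV : V * V ≤ V} {x : A} :
    x ∈ unitalHull V hV ↔ ∃ r : k, ∃ v ∈ V, x = algebraMap k A r + v := Iff.rfl

theorem finrank_unitalHull [Module.Finite k A] (V : Submodule k A) (hV : V * V ≤ V)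
    (h1 : (1 : A) ∉ V) :
    Module.finrank k (unitalHull V hV) = Module.finrank k V + 1 := by
  have hne : (1 : A) ≠ 0 := fun h => h1 (h ▸ V.zero_mem)
  have hsup : Subalgebra.toSubmodule (unitalHull V hV) = Submodule.span k {(1 : A)} ⊔ V := by
    ext x
    simp [mem_unitalHull, Submodule.mem_sup, Submodule.mem_span_singleton,
      Algebra.algebraMap_eq_smul_one, eq_comm]
  have hinf : Submodule.span k {(1 : A)} ⊓ V = ⊥ := by
    rw [eq_bot_iff]
    rintro x ⟨hx, hxV⟩
    obtain ⟨r, rfl⟩ := Submodule.mem_span_singleton.mp hx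
    by_contra hr
    have hr0 : r ≠ 0 := fun h => hr (by simp [h])
    exact h1 ((V.smul_mem_iff hr0).mp hxV)
  have h := Submodule.finrank_sup_add_finrank_inf_eq (Submodule.span k {(1 : A)}) V
  rw [hinf, finrank_bot, ← hsup, finrank_span_singleton hne] at h
  rw [← Subalgebra.finrank_toSubmodule]
  lia

/-- A subspace closed under multiplication and consisting of nilpotent elements contains subspaces
closed under multiplication of every smaller dimension. -/
theorem exists_mul_le_finrank_eq [Module.Finite k A] (V : Submodule k A) (hV : V * V ≤ V)
    (hnil : ∀ x ∈ V, IsNilpotent x) {e : ℕ} (he : e ≤ Module.finrank k V) :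
    ∃ W ≤ V, W * W ≤ W ∧ Module.finrank k W = e := by
  induction he using Nat.decreasingInduction with
  | self => exact ⟨V, le_rfl, hV, rfl⟩
  | of_succ e he ih =>
    obtain ⟨W, hWV, hW, hWe⟩ := ih
    have hlt : W * W < W := by
      refine lt_of_le_of_ne hW fun heq => ?_
      have : IsNoetherianRing A := IsNoetherianRing.of_finite k A
      obtain ⟨n, hn⟩ := IsNoetherianRing.isNilpotent_nilradical A
      have hpow : ∀ n : ℕ, ∀ x ∈ W, x ∈ nilradical A ^ n := by
        intro n
        induction n with
        | zero => simp
        | succ n ih =>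
          intro x hx
          rw [← heq] at hx
          refine Submodule.mul_induction_on hx (fun a ha b hb => ?_) fun a b => Ideal.add_mem _
          rw [pow_succ]
          exact Ideal.mul_mem_mul (ih a ha) (hnil b (hWV hb))
      have hbot : W = ⊥ := by
        rw [eq_bot_iff]
        intro x hx
        simpa [hn] using hpow n x hx
      rw [hbot, finrank_bot] at hWe
      lia
    obtain ⟨U, hU, hcov⟩ := exists_le_covBy_of_lt hlt
    refine ⟨U, hcov.le.trans hWV, (mul_le_mul' hcov.le hcov.le).trans hU, ?_⟩
    have hs := (covBy_iff_quot_is_simple hcov.le).mp hcov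
    rw [isSimpleModule_iff_finrank_eq_one] at hs
    have h := Submodule.finrank_quotient_add_finrank (U.submoduleOf W)
    rw [(Submodule.submoduleOfEquivOfLe hcov.le).finrank_eq, hWe] at h
    change Module.finrank k (W ⧸ U.submoduleOf W) = 1 at hs
    lia

end UnitalHull

section EvenConductances

variable {k : Type*} [Field k] {ι : Type*} (c : ι → ℕ)

/-- The tuple of constant terms. -/
noncomputable def constTerms (k : Type*) [Field k] {ι : Type*} (c : ι → ℕ) (hc : ∀ i, 1 ≤ c i) :
    TruncPi k c →ₐ[k] (ι → k) :=
  AlgHom.pi fun i =>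
    (constTerm k (c i) (hc i)).comp (Pi.evalAlgHom k (fun i => TruncP k (c i)) i)

/-- The tuples with vanishing constant terms. -/
noncomputable def maxPart (k : Type*) [Field k] {ι : Type*} (c : ι → ℕ) (hc : ∀ i, 1 ≤ c i) :
    Submodule k (TruncPi k c) :=
  LinearMap.ker (constTerms k c hc).toLinearMap

theorem mem_maxPart {hc : ∀ i, 1 ≤ c i} {x : TruncPi k c} :
    x ∈ maxPart k c hc ↔ ∀ i, constTerm k (c i) (hc i) (x i) = 0 := by
  simp [maxPart, constTerms, funext_iff]

theorem maxPart_mul_le (hc : ∀ i, 1 ≤ c i) :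
    maxPart k c hc * maxPart k c hc ≤ maxPart k c hc := by
  rw [Submodule.mul_le]
  intro x hx y hy
  rw [mem_maxPart] at *
  intro i
  rw [Pi.mul_apply, map_mul, hx i, zero_mul]

theorem finrank_maxPart [Fintype ι] (hc : ∀ i, 1 ≤ c i) :
    Module.finrank k (maxPart k c hc) + Fintype.card ι = ∑ i, c i := by
  have := fun i => finite_truncP (k := k) (c i)
  have h := LinearMap.finrank_range_add_finrank_ker (constTerms k c hc).toLinearMap
  have hsurj : LinearMap.range (constTerms k c hc).toLinearMap = ⊤ := by
    rw [LinearMap.range_eq_top]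
    intro a
    exact ⟨fun i => algebraMap k _ (a i), by ext i; simp [constTerms]⟩
  rw [hsurj, finrank_top, Module.finrank_fintype_fun_eq_card, Module.finrank_pi_fintype] at h
  simp only [finrank_truncP] at h
  rw [← h, add_comm, maxPart]

theorem Aplus_eq_unitalHull [Nonempty ι] (hc : ∀ i, 1 ≤ c i) :
    Aplus k c hc = unitalHull (maxPart k c hc) (maxPart_mul_le c hc) := by
  ext x
  simp only [Aplus, Algebra.mem_iInf, AlgHom.mem_equalizer, mem_unitalHull]
  constructor
  · intro h
    obtain ⟨i₀⟩ := ‹Nonempty ι›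
    refine ⟨constTerm k _ (hc i₀) (x i₀), x - algebraMap k _ (constTerm k _ (hc i₀) (x i₀)),
      ?_, by ring⟩
    rw [mem_maxPart]
    intro i
    have := h i i₀
    simp only [AlgHom.comp_apply, Pi.evalAlgHom_apply] at this
    rw [Pi.sub_apply, map_sub, this, Pi.algebraMap_apply, AlgHom.commutes]
    simp
  · rintro ⟨r, v, hv, rfl⟩ i j
    rw [mem_maxPart] at hv
    simp [hv]

/-- The conditions cutting out the tuples whose constant terms and odd coefficients below the top
degree vanish, and whose top coefficients sum to zero. -/
noncomputable def evenConditions (k : Type*) [Field k] {ι : Type*} [Fintype ι] (c : ι → ℕ) :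
    TruncPi k c →ₗ[k] ((Σ i, Fin (c i / 2)) → k) × k :=
  (LinearMap.pi fun p => (truncCoeff k (c p.1) (2 * p.2 - 1)).comp (LinearMap.proj p.1)).prod
    (∑ i, (truncCoeff k (c i) (c i - 1)).comp (LinearMap.proj i))

theorem mem_ker_evenConditions [Fintype ι] (hc : ∀ i, 1 ≤ c i) (heven : ∀ i, Even (c i)) {x : TruncPi k c} :
    x ∈ LinearMap.ker (evenConditions k c) ↔
      (∀ i, truncCoeff k (c i) 0 (x i) = 0) ∧
      (∀ i j, Odd j → j < c i - 1 → truncCoeff k (c i) j (x i) = 0) ∧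
      ∑ i, truncCoeff k (c i) (c i - 1) (x i) = 0 := by
  have h : x ∈ LinearMap.ker (evenConditions k c) ↔
      (∀ p : Σ i, Fin (c i / 2), truncCoeff k (c p.1) (2 * p.2 - 1) (x p.1) = 0) ∧
      ∑ i, truncCoeff k (c i) (c i - 1) (x i) = 0 := by
    simp [evenConditions, funext_iff]
  rw [h, ← and_assoc]
  refine and_congr_left fun _ => ⟨fun h => ⟨fun i => ?_, fun i j hj hlt => ?_⟩, ?_⟩
  · have := heven i
    have := hc i
    exact h ⟨i, 0, by grind⟩
  · obtain ⟨s, rfl⟩ := hj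
    exact h ⟨i, s + 1, by grind⟩
  · rintro ⟨h0, hodd⟩ ⟨i, s, hs⟩
    rcases s with _ | s
    · exact h0 i
    · exact hodd i _ ⟨s, by simp; lia⟩ (by simp; lia)

theorem ker_evenConditions_mul_le [Fintype ι] (hc : ∀ i, 1 ≤ c i) (heven : ∀ i, Even (c i)) :
    LinearMap.ker (evenConditions k c) * LinearMap.ker (evenConditions k c) ≤
      LinearMap.ker (evenConditions k c) := by
  rw [Submodule.mul_le]
  intro x hx y hy
  rw [mem_ker_evenConditions c hc heven] at *
  obtain ⟨hx0, hxo, -⟩ := hx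
  obtain ⟨hy0, hyo, -⟩ := hy
  have hodd : ∀ i j, Odd j → j < c i → truncCoeff k (c i) j ((x * y) i) = 0 := by
    intro i j hj hlt
    rw [Pi.mul_apply, truncCoeff_mul hlt]
    refine Finset.sum_eq_zero fun p hp => ?_
    rw [Finset.HasAntidiagonal.mem_antidiagonal] at hp
    rw [← hp, Nat.odd_add] at hj
    rcases Nat.even_or_odd p.2 with h | h
    · rcases Nat.eq_zero_or_pos p.2 with h0 | h0
      · rw [h0, hy0, mul_zero]
      · rw [hxo i p.1 (hj.mpr h) (by lia), zero_mul]
    · rcases Nat.eq_zero_or_pos p.1 with h0 | h0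
      · rw [h0, hx0, zero_mul]
      · rw [hyo i p.2 h (by lia), mul_zero]
  refine ⟨fun i => ?_, fun i j hj hlt => hodd i j hj (by lia), ?_⟩
  · rw [Pi.mul_apply, truncCoeff_mul (hc i)]
    simp [hx0]
  · exact Finset.sum_eq_zero fun i _ => hodd i _ (Nat.Even.sub_odd (hc i) (heven i) odd_one)
      (by have := hc i; lia)

theorem le_finrank_ker_evenConditions [Fintype ι] :
    ∑ i, c i ≤ Module.finrank k (LinearMap.ker (evenConditions k c)) + ∑ i, c i / 2 + 1 := by
  have := fun i => finite_truncP (k := k) (c i)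
  have h := LinearMap.finrank_range_add_finrank_ker (evenConditions k c)
  have hr := (LinearMap.range (evenConditions k c)).finrank_le
  rw [Module.finrank_prod, Module.finrank_fintype_fun_eq_card, Module.finrank_self,
    Fintype.card_sigma] at hr
  rw [Module.finrank_pi_fintype] at h
  simp only [finrank_truncP] at h
  simp only [Fintype.card_fin] at hr
  lia

theorem one_notMem_maxPart [Nonempty ι] (hc : ∀ i, 1 ≤ c i) : 1 ∉ maxPart k c hc := by
  rw [mem_maxPart]
  intro h
  obtain ⟨i⟩ := ‹Nonempty ι›
  simpa using h i

theorem ker_evenConditions_le_maxPart [Fintype ι] (hc : ∀ i, 1 ≤ c i) (heven : ∀ i, Even (c i)) :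
    LinearMap.ker (evenConditions k c) ≤ maxPart k c hc := by
  intro x hx
  rw [mem_maxPart]
  intro i
  rw [constTerm_eq_truncCoeff]
  exact ((mem_ker_evenConditions c hc heven).mp hx).1 i

theorem isNilpotent_of_mem_maxPart [Fintype ι] {hc : ∀ i, 1 ≤ c i} {x : TruncPi k c}
    (hx : x ∈ maxPart k c hc) : IsNilpotent x := by
  rw [mem_maxPart] at hx
  choose n hn using fun i => isNilpotent_of_constTerm_eq_zero (hc i) (hx i)
  refine ⟨∑ i, n i, funext fun i => ?_⟩
  exact pow_eq_zero_of_le (Finset.single_le_sum (fun _ _ => Nat.zero_le _) (Finset.mem_univ i))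
    (hn i)

theorem tpow_notMem_unitalHull [Fintype ι] [DecidableEq ι] (hc : ∀ i, 1 ≤ c i) (heven : ∀ i, Even (c i))
    {W : Submodule k (TruncPi k c)} (hW : W * W ≤ W)
    (hWle : W ≤ LinearMap.ker (evenConditions k c)) (i : ι) :
    tpow c i (c i - 1) ∉ unitalHull W hW := by
  rintro ⟨r, v, hv, h⟩
  have h2 : 2 ≤ c i := by
    have := hc i
    have := heven i
    grind
  obtain ⟨hv0, -, hsum⟩ := (mem_ker_evenConditions c hc heven).mp (hWle hv)
  have hr : r = 0 := by
    have := congrArg (fun x : TruncPi k c => constTerm k (c i) (hc i) (x i)) h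
    simp only [tpow, Pi.single_eq_same, Pi.add_apply, map_add, Pi.algebraMap_apply,
      AlgHom.commutes] at this
    rw [constTerm_eq_truncCoeff, constTerm_eq_truncCoeff, hv0, truncCoeff_truncX_pow (by lia),
      if_neg (by lia)] at this
    simpa using this.symm
  rw [hr, map_zero, zero_add] at h
  rw [← h, Finset.sum_eq_single i] at hsum
  · rw [tpow, Pi.single_eq_same, truncCoeff_truncX_pow (by lia), if_pos rfl] at hsum
    exact one_ne_zero hsum
  · intro j _ hj
    rw [tpow, Pi.single_eq_of_ne hj, map_zero]
  · simp

end EvenConductances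

/-- over an algebraically closed field, for any `g ≥ 0` and any vector of even
positive conductances `c` with `g + m - 1 < ∑ cᵢ ≤ 2(g + m - 1)`, there is a corank-`g`
subalgebra of `A⁺` containing none of the monomials `tᵢ^{cᵢ-1}` (i.e. a genus-`g` reduced
curve singularity with conductances exactly `c`). -/
theorem exists_singularity_even_conductances
    {k : Type*} [Field k] [IsAlgClosed k] {m : ℕ} (hm : 1 ≤ m)
    (g : ℕ) (c : Fin m → ℕ) (hcpos : ∀ i, 1 ≤ c i) (hceven : ∀ i, Even (c i))
    (h1 : g + m - 1 < ∑ i, c i) (h2 : ∑ i, c i ≤ 2 * (g + m - 1)) :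
    ∃ B : Subalgebra k (TruncPi k c),
      B ≤ Aplus k c hcpos ∧
      Module.finrank k ↥B + g = Module.finrank k ↥(Aplus k c hcpos) ∧
      ∀ i, tpow c i (c i - 1) ∉ B := by
  have : Nonempty (Fin m) := ⟨⟨0, hm⟩⟩
  have := fun i => finite_truncP (k := k) (c i)
  have hle := ker_evenConditions_le_maxPart (k := k) c hcpos hceven
  have hJ := finrank_maxPart (k := k) c hcpos
  have hM := le_finrank_ker_evenConditions (k := k) c
  have hhalf : 2 * ∑ i, c i / 2 = ∑ i, c i := by
    rw [Finset.mul_sum]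
    exact Finset.sum_congr rfl fun i _ => Nat.two_mul_div_two_of_even (hceven i)
  rw [Fintype.card_fin] at hJ
  obtain ⟨W, hWle, hW, hWe⟩ := exists_mul_le_finrank_eq (LinearMap.ker (evenConditions k c))
    (ker_evenConditions_mul_le c hcpos hceven)
    (fun x hx => isNilpotent_of_mem_maxPart c (hle hx))
    (e := Module.finrank k (maxPart k c hcpos) - g) (by omega)
  have h1J := one_notMem_maxPart (k := k) c hcpos
  refine ⟨unitalHull W hW, ?_, ?_, tpow_notMem_unitalHull c hcpos hceven hW hWle⟩
  · rw [Aplus_eq_unitalHull]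
    rintro x ⟨r, v, hv, rfl⟩
    exact ⟨r, v, hle (hWle hv), rfl⟩
  · rw [Aplus_eq_unitalHull, finrank_unitalHull _ _ h1J,
      finrank_unitalHull _ _ fun h => h1J (hle (hWle h)), hWe]
    omega
end

section
/- Fix a field k, c⃗ = (c₁,…,c_m), and a partition {1,…,m} = I ⊔ I' into nonempty subsets. Grade A⁺_{c⃗} by declaring deg(tᵢ^j) = j for i ∈ I and deg(tᵢ^j) = 0 for i ∈ I' (so the degree-0 component is k·1 ⊕ m_{I'} and the degree-d component for d ≥ 1 is span_k{tᵢ^d : i ∈ I, d ≤ cᵢ−1}). For a k-subalgebra B ⊆ A⁺_{c⃗}, let in(B) = span_k{in(b) : b ∈ B, b ≠ 0}, where in(b) is the nonzero homogeneous component of b of least degree. Then in(B) is a k-subalgebra of A⁺_{c⃗} of the same k-dimension as B which is decomposable: in(B) = k·1 ⊕ (in(B) ∩ m_I) ⊕ (in(B) ∩ m_{I'}), i.e., in(B) is the join of the two multiplicatively closed subspaces in(B) ∩ m_I ⊆ m_I and in(B) ∩ m_{I'} ⊆ m_{I'}. -/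
set_option synthInstance.maxHeartbeats 1000000
set_option maxHeartbeats 2000000
open Polynomial

section GradedTail

variable {k V : Type*} [Field k] [AddCommGroup V] [Module k V]

/-- The submodule spanned by the pieces of degree at least `d`. -/
def gradedTail (P : ℕ → Submodule k V) (d : ℕ) : Submodule k V :=
  ⨆ e : ℕ, ⨆ _ : d ≤ e, P e

/-- The homogeneous elements of degree `d` which are leading forms of elements of `B`,
together with `0`. -/
def leadingPiece (P : ℕ → Submodule k V) (B : Submodule k V) (d : ℕ) : Submodule k V :=
  P d ⊓ (B ⊔ gradedTail P (d + 1))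

theorem le_gradedTail (P : ℕ → Submodule k V) {d e : ℕ} (h : d ≤ e) : P e ≤ gradedTail P d :=
  le_iSup₂_of_le (f := fun e (_ : d ≤ e) => P e) e h le_rfl

theorem gradedTail_le {P : ℕ → Submodule k V} {d : ℕ} {W : Submodule k V}
    (h : ∀ e, d ≤ e → P e ≤ W) : gradedTail P d ≤ W :=
  iSup₂_le h

theorem gradedTail_antitone (P : ℕ → Submodule k V) : Antitone (gradedTail P) :=
  fun _ _ h => gradedTail_le fun _ he => le_gradedTail P (h.trans he)

theorem gradedTail_eq_sup (P : ℕ → Submodule k V) (d : ℕ) :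
    gradedTail P d = P d ⊔ gradedTail P (d + 1) := by
  apply le_antisymm
  · refine gradedTail_le fun e he => ?_
    rcases he.eq_or_lt with rfl | h
    · exact le_sup_left
    · exact (le_gradedTail P (Nat.succ_le_of_lt h)).trans le_sup_right
  · exact sup_le (le_gradedTail P le_rfl) (gradedTail_antitone P d.le_succ)

theorem mem_leadingPiece {P : ℕ → Submodule k V} {B : Submodule k V} {d : ℕ} {x : V} :
    x ∈ leadingPiece P B d ↔ x ∈ P d ∧ ∃ b ∈ B, b - x ∈ gradedTail P (d + 1) := by
  rw [leadingPiece, Submodule.mem_inf, Submodule.mem_sup]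
  refine and_congr_right fun _ => ⟨?_, ?_⟩
  · rintro ⟨b, hb, f, hf, rfl⟩
    exact ⟨b, hb, by simpa using hf⟩
  · rintro ⟨b, hb, hf⟩
    exact ⟨b, hb, x - b, by simpa using neg_mem hf, by abel⟩

theorem leadingPiece_le (P : ℕ → Submodule k V) (B : Submodule k V) (d : ℕ) :
    leadingPiece P B d ≤ P d :=
  inf_le_left

theorem span_leading_forms (P : ℕ → Submodule k V) (B : Submodule k V) :
    Submodule.span k {x | ∃ b ∈ B, ∃ d : ℕ, x ∈ P d ∧ x ≠ 0 ∧ b - x ∈ gradedTail P (d + 1)} =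
      gradedTail (leadingPiece P B) 0 := by
  apply le_antisymm
  · rw [Submodule.span_le]
    rintro x ⟨b, hb, d, hx, -, hbx⟩
    exact le_gradedTail _ d.zero_le (mem_leadingPiece.2 ⟨hx, b, hb, hbx⟩)
  · refine gradedTail_le fun d _ x hx => ?_
    obtain ⟨hx, b, hb, hbx⟩ := mem_leadingPiece.1 hx
    rcases eq_or_ne x 0 with rfl | h0
    · exact zero_mem _
    · exact Submodule.subset_span ⟨b, hb, d, hx, h0, hbx⟩

theorem finrank_gradedTail_leadingPiece [FiniteDimensional k V] {P : ℕ → Submodule k V}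
    (hdisj : ∀ d, Disjoint (P d) (gradedTail P (d + 1))) {N : ℕ} (hN : ∀ d, N ≤ d → P d = ⊥)
    (B : Submodule k V) (d : ℕ) :
    Module.finrank k (gradedTail (leadingPiece P B) d) =
      Module.finrank k ↥(B ⊓ gradedTail P d) := by
  obtain ⟨n, hn⟩ : ∃ n, N ≤ d + n := ⟨N, by omega⟩
  induction n generalizing d with
  | zero =>
    have hP : gradedTail P d = ⊥ :=
      eq_bot_iff.2 (gradedTail_le fun e he => (hN e (by omega)).le)
    have hL : gradedTail (leadingPiece P B) d = ⊥ :=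
      eq_bot_iff.2 (gradedTail_le fun e he =>
        (leadingPiece_le P B e).trans (hN e (by omega)).le)
    rw [hP, hL, inf_bot_eq]
  | succ n ih =>
    specialize ih (d + 1) (by omega)
    have hle : gradedTail P (d + 1) ≤ gradedTail P d := gradedTail_antitone P d.le_succ
    have hmod : (B ⊓ gradedTail P d) ⊔ gradedTail P (d + 1) =
        leadingPiece P B d ⊔ gradedTail P (d + 1) := by
      rw [leadingPiece, inf_comm (P d), inf_sup_assoc_of_le _ le_sup_right,
        ← gradedTail_eq_sup, inf_comm B, inf_sup_assoc_of_le _ hle, inf_comm]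
    have htail : gradedTail (leadingPiece P B) (d + 1) ≤ gradedTail P (d + 1) :=
      gradedTail_le fun e he => (leadingPiece_le P B e).trans (le_gradedTail P he)
    have h1 := Submodule.finrank_sup_add_finrank_inf_eq (B ⊓ gradedTail P d)
      (gradedTail P (d + 1))
    have h2 := Submodule.finrank_sup_add_finrank_inf_eq (leadingPiece P B d)
      (gradedTail P (d + 1))
    have h3 := Submodule.finrank_sup_add_finrank_inf_eq (leadingPiece P B d)
      (gradedTail (leadingPiece P B) (d + 1))
    have hd2 : leadingPiece P B d ⊓ gradedTail P (d + 1) = ⊥ :=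
      ((hdisj d).mono_left (leadingPiece_le P B d)).eq_bot
    have hd3 : leadingPiece P B d ⊓ gradedTail (leadingPiece P B) (d + 1) = ⊥ :=
      ((hdisj d).mono (leadingPiece_le P B d) htail).eq_bot
    rw [hmod, inf_assoc, inf_eq_right.2 hle] at h1
    rw [hd2, finrank_bot] at h2
    rw [hd3, finrank_bot, ← gradedTail_eq_sup] at h3
    omega

end GradedTail

section GradedTailMul

variable {k A : Type*} [Field k] [CommRing A] [Algebra k A]

theorem gradedTail_mul_le {P : ℕ → Submodule k A} (hP : ∀ d e, P d * P e ≤ P (d + e))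
    (d e : ℕ) : gradedTail P d * gradedTail P e ≤ gradedTail P (d + e) := by
  simp only [gradedTail, Submodule.iSup_mul, Submodule.mul_iSup]
  exact iSup₂_le fun a ha => iSup₂_le fun b hb =>
    (hP _ _).trans (le_gradedTail P (by omega))

theorem leadingPiece_mul_le {P : ℕ → Submodule k A} (hP : ∀ d e, P d * P e ≤ P (d + e))
    (B : Subalgebra k A) (d e : ℕ) :
    leadingPiece P (Subalgebra.toSubmodule B) d * leadingPiece P (Subalgebra.toSubmodule B) e ≤
      leadingPiece P (Subalgebra.toSubmodule B) (d + e) := by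
  rw [Submodule.mul_le]
  intro x hx y hy
  obtain ⟨hx, b, hb, hbx⟩ := mem_leadingPiece.1 hx
  obtain ⟨hy, b', hb', hby⟩ := mem_leadingPiece.1 hy
  refine mem_leadingPiece.2 ⟨hP d e (Submodule.mul_mem_mul hx hy), b * b', B.mul_mem hb hb', ?_⟩
  have hbd : b ∈ gradedTail P d := by
    have := add_mem (gradedTail_antitone P d.le_succ hbx) (le_gradedTail P le_rfl hx)
    simpa using this
  have h1 := gradedTail_mul_le hP _ _ (Submodule.mul_mem_mul hbd hby)
  have h2 := gradedTail_mul_le hP _ _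
    (Submodule.mul_mem_mul hbx (le_gradedTail P (le_refl e) hy))
  have h := add_mem h1
    (gradedTail_antitone P (by omega) h2 : (b - x) * y ∈ gradedTail P (d + (e + 1)))
  rw [← add_assoc] at h
  convert h using 1
  ring

theorem one_mem_gradedTail_leadingPiece {P : ℕ → Submodule k A} (h1 : (1 : A) ∈ P 0)
    (B : Subalgebra k A) : (1 : A) ∈ gradedTail (leadingPiece P (Subalgebra.toSubmodule B)) 0 :=
  le_gradedTail _ le_rfl (mem_leadingPiece.2
    ⟨h1, 1, one_mem B, by rw [sub_self]; exact zero_mem _⟩)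

theorem mul_mem_gradedTail_leadingPiece {P : ℕ → Submodule k A}
    (hP : ∀ d e, ∀ x ∈ P d, ∀ y ∈ P e, x * y ∈ P (d + e)) (B : Subalgebra k A) {x y : A}
    (hx : x ∈ gradedTail (leadingPiece P (Subalgebra.toSubmodule B)) 0)
    (hy : y ∈ gradedTail (leadingPiece P (Subalgebra.toSubmodule B)) 0) :
    x * y ∈ gradedTail (leadingPiece P (Subalgebra.toSubmodule B)) 0 :=
  gradedTail_mul_le (leadingPiece_mul_le (fun d e => Submodule.mul_le.2 (hP d e)) B) 0 0
    (Submodule.mul_mem_mul hx hy)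

theorem span_one_sup_mul (M N : Submodule k A) :
    (Submodule.span k {1} ⊔ M) * N = N ⊔ M * N := by
  rw [← Submodule.one_eq_span, Submodule.sup_mul, one_mul]

theorem mul_span_one_sup (M N : Submodule k A) :
    N * (Submodule.span k {1} ⊔ M) = N ⊔ M * N := by
  rw [mul_comm, span_one_sup_mul]

end GradedTailMul

section Truncated

variable {k : Type*} [Field k]

theorem truncX_pow_eq_zero {c j : ℕ} (h : c ≤ j) : truncX k c ^ j = 0 := by
  refine pow_eq_zero_of_le h ?_
  rw [truncX, ← map_pow, Ideal.Quotient.eq_zero_iff_mem]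
  exact Ideal.mem_span_singleton_self _

theorem smul_truncX_pow_eq_zero {c d : ℕ} {r : k} {y : TruncP k c}
    (h : r • truncX k c ^ d = truncX k c ^ (d + 1) * y) : r • truncX k c ^ d = 0 := by
  rcases eq_or_ne r 0 with rfl | hr
  · exact zero_smul _ _
  have hn : IsNilpotent (truncX k c * (r⁻¹ • y)) :=
    (Commute.all _ _).isNilpotent_mul_right ⟨c, truncX_pow_eq_zero le_rfl⟩
  have hu : IsUnit (1 - truncX k c * (r⁻¹ • y)) := hn.isUnit_one_sub
  have h0 : truncX k c ^ d * (1 - truncX k c * (r⁻¹ • y)) = 0 := by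
    have h' : truncX k c ^ d = r⁻¹ • (truncX k c ^ (d + 1) * y) := by
      rw [← h, smul_smul, inv_mul_cancel₀ hr, one_smul]
    rw [mul_sub, mul_one, ← mul_assoc, ← pow_succ, mul_smul_comm, ← h', sub_self]
  rw [hu.mul_left_eq_zero.1 h0, smul_zero]

theorem constTerm_truncX (c : ℕ) (hc : 1 ≤ c) : constTerm k c hc (truncX k c) = 0 := by
  change aeval (0 : k) X = 0
  simp

theorem mem_span_truncX_pow {c : ℕ} (hc : 1 ≤ c) {x : TruncP k c}
    (hx : constTerm k c hc x = 0) :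
    x ∈ Submodule.span k {y | ∃ j, 1 ≤ j ∧ j < c ∧ y = truncX k c ^ j} := by
  obtain ⟨p, rfl⟩ := Ideal.Quotient.mk_surjective x
  have hp : p.coeff 0 = 0 := by
    change aeval (0 : k) p = 0 at hx
    rw [coeff_zero_eq_aeval_zero]
    simpa using hx
  have hsum : Ideal.Quotient.mk (Ideal.span {(X : Polynomial k) ^ c}) p =
      ∑ j ∈ p.support, p.coeff j • truncX k c ^ j := by
    conv_lhs => rw [p.as_sum_support_C_mul_X_pow]
    rw [map_sum]
    refine Finset.sum_congr rfl fun j _ => ?_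
    rw [← smul_eq_C_mul, truncX, ← map_pow]
    rfl
  rw [hsum]
  refine Submodule.sum_mem _ fun j hj => ?_
  by_cases hjc : j < c
  · refine Submodule.smul_mem _ _ (Submodule.subset_span ⟨j, ?_, hjc, rfl⟩)
    rcases Nat.eq_zero_or_pos j with rfl | h
    · exact absurd hp (mem_support_iff.1 hj)
    · exact h
  · rw [truncX_pow_eq_zero (not_lt.1 hjc), smul_zero]
    exact zero_mem _

instance truncP_finite (c : ℕ) : Module.Finite k (TruncP k c) :=
  (monic_X_pow c).finite_quotient

theorem mem_Aplus {ι : Type*} (c : ι → ℕ) (hc : ∀ i, 1 ≤ c i) {x : TruncPi k c} :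
    x ∈ Aplus k c hc ↔
      ∀ i j, constTerm k (c i) (hc i) (x i) = constTerm k (c j) (hc j) (x j) := by
  simp only [Aplus, Algebra.mem_iInf, AlgHom.mem_equalizer]
  rfl

variable {ι : Type*} [DecidableEq ι] (c : ι → ℕ)

theorem tpow_eq_zero {i : ι} {j : ℕ} (h : c i ≤ j) : (tpow c i j : TruncPi k c) = 0 := by
  rw [tpow, truncX_pow_eq_zero h, Pi.single_zero]

theorem tpow_mul_tpow (i : ι) (j j' : ℕ) :
    (tpow c i j * tpow c i j' : TruncPi k c) = tpow c i (j + j') := by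
  rw [tpow, tpow, tpow, ← Pi.single_mul, pow_add]

theorem tpow_mul_tpow_of_ne {i i' : ι} (h : i ≠ i') (j j' : ℕ) :
    (tpow c i j * tpow c i' j' : TruncPi k c) = 0 := by
  funext l
  rcases eq_or_ne l i with rfl | hl
  · simp [tpow, h]
  · simp [tpow, hl]

theorem mPart_mul_le (I : Set ι) : mPart k c I * mPart k c I ≤ mPart k c I := by
  rw [mPart, Submodule.span_mul_span, Submodule.span_le]
  rintro _ ⟨_, ⟨i, hi, j, hj, hjc, rfl⟩, _, ⟨i', hi', j', hj', hjc', rfl⟩, rfl⟩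
  change tpow c i j * tpow c i' j' ∈ _
  rcases eq_or_ne i i' with rfl | h
  · rw [tpow_mul_tpow]
    by_cases hs : j + j' < c i
    · exact Submodule.subset_span ⟨i, hi, j + j', by omega, hs, rfl⟩
    · rw [tpow_eq_zero c (not_lt.1 hs)]
      exact zero_mem _
  · rw [tpow_mul_tpow_of_ne c h]
    exact zero_mem _

theorem mul_mem_mPart {I : Set ι} {x y : TruncPi k c} (hx : x ∈ mPart k c I)
    (hy : y ∈ mPart k c I) : x * y ∈ mPart k c I :=
  mPart_mul_le c I (Submodule.mul_mem_mul hx hy)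

theorem tpow_mem_Aplus (hc : ∀ i, 1 ≤ c i) (i : ι) {j : ℕ} (hj : 1 ≤ j) :
    (tpow c i j : TruncPi k c) ∈ Aplus k c hc := by
  have h0 : ∀ l, constTerm k (c l) (hc l) ((tpow c i j : TruncPi k c) l) = 0 := by
    intro l
    rcases eq_or_ne l i with rfl | hl
    · simp [tpow, constTerm_truncX, Nat.one_le_iff_ne_zero.1 hj]
    · simp [tpow, hl]
  exact (mem_Aplus c hc).2 fun a b => (h0 a).trans (h0 b).symm

theorem Aplus_le_span_one_sup_mPart [Finite ι] (hc : ∀ i, 1 ≤ c i) :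
    Subalgebra.toSubmodule (Aplus k c hc) ≤
      Submodule.span k {(1 : TruncPi k c)} ⊔ mPart k c Set.univ := by
  cases nonempty_fintype ι
  intro x hx
  rcases isEmpty_or_nonempty ι with h | ⟨⟨i₀⟩⟩
  · rw [Subsingleton.elim x 0]
    exact zero_mem _
  have hx' := (mem_Aplus c hc).1 hx
  set r := constTerm k (c i₀) (hc i₀) (x i₀)
  have hxr : x = r • (1 : TruncPi k c) + (x - r • 1) := by abel
  rw [hxr]
  refine add_mem (le_sup_left (a := Submodule.span k {(1 : TruncPi k c)})
    (Submodule.smul_mem _ _ (Submodule.mem_span_singleton_self _)))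
    (le_sup_right (b := mPart k c Set.univ) ?_)
  rw [← Finset.univ_sum_single (x - r • (1 : TruncPi k c))]
  refine Submodule.sum_mem _ fun i _ => ?_
  have hi : constTerm k (c i) (hc i) ((x - r • (1 : TruncPi k c)) i) = 0 := by
    simp [hx' i i₀, r]
  have hmem := Submodule.mem_map_of_mem
    (f := LinearMap.single k (fun i => TruncP k (c i)) i) (mem_span_truncX_pow (hc i) hi)
  rw [Submodule.map_span] at hmem
  refine Submodule.span_mono ?_ hmem
  rintro _ ⟨_, ⟨j, hj, hjc, rfl⟩, rfl⟩
  exact ⟨i, Set.mem_univ i, j, hj, hjc, rfl⟩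

end Truncated

section OneParameterGrading

variable {k : Type*} [Field k] {ι : Type*} [Fintype ι] [DecidableEq ι] (c : ι → ℕ) (I : Finset ι)

variable (k) in
/-- The degree `d` part of `A⁺` when `tᵢ` has degree `1` for `i ∈ I` and degree `0` otherwise. -/
noncomputable def weightPiece (d : ℕ) : Submodule k (TruncPi k c) :=
  if d = 0 then
    Submodule.span k ({1} ∪ {x | ∃ i ∈ Iᶜ, ∃ j, 1 ≤ j ∧ j < c i ∧ x = tpow c i j})
  else Submodule.span k {x | ∃ i ∈ I, d < c i ∧ x = tpow c i d}

theorem weightPiece_zero :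
    weightPiece k c I 0 = Submodule.span k {1} ⊔ mPart k c ↑(Iᶜ) := by
  rw [weightPiece, if_pos rfl, Submodule.span_union]
  rfl

theorem one_mem_weightPiece_zero : (1 : TruncPi k c) ∈ weightPiece k c I 0 := by
  rw [weightPiece_zero]
  exact Submodule.mem_sup_left (Submodule.mem_span_singleton_self _)

theorem weightPiece_of_ne_zero {d : ℕ} (hd : d ≠ 0) :
    weightPiece k c I d = Submodule.span k {x | ∃ i ∈ I, d < c i ∧ x = tpow c i d} :=
  if_neg hd

theorem weightPiece_le_mPart {d : ℕ} (hd : d ≠ 0) : weightPiece k c I d ≤ mPart k c ↑I := by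
  rw [weightPiece_of_ne_zero c I hd]
  refine Submodule.span_mono ?_
  rintro x ⟨i, hi, hdc, rfl⟩
  exact ⟨i, hi, d, by omega, hdc, rfl⟩

theorem mPart_compl_mul_weightPiece {d : ℕ} (hd : d ≠ 0) :
    mPart k c ↑(Iᶜ) * weightPiece k c I d = ⊥ := by
  rw [weightPiece_of_ne_zero c I hd, mPart, Submodule.span_mul_span, Submodule.span_eq_bot]
  rintro _ ⟨_, ⟨i, hi, j, hj, hjc, rfl⟩, _, ⟨i', hi', hdc, rfl⟩, rfl⟩
  refine tpow_mul_tpow_of_ne c ?_ _ _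
  rintro rfl
  exact Finset.mem_compl.1 hi hi'

theorem weightPiece_zero_mul_le (d : ℕ) :
    weightPiece k c I 0 * weightPiece k c I d ≤ weightPiece k c I d := by
  rcases eq_or_ne d 0 with rfl | hd
  · rw [weightPiece_zero, span_one_sup_mul, mul_span_one_sup]
    exact sup_le le_rfl (sup_le le_sup_right ((mPart_mul_le c _).trans le_sup_right))
  · rw [weightPiece_zero, span_one_sup_mul, mPart_compl_mul_weightPiece c I hd, sup_bot_eq]

theorem weightPiece_mul_le (d e : ℕ) :
    weightPiece k c I d * weightPiece k c I e ≤ weightPiece k c I (d + e) := by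
  rcases eq_or_ne d 0 with rfl | hd
  · rw [zero_add]
    exact weightPiece_zero_mul_le c I e
  rcases eq_or_ne e 0 with rfl | he
  · rw [add_zero, weightPiece_zero, mul_span_one_sup, ← span_one_sup_mul, ← weightPiece_zero]
    exact weightPiece_zero_mul_le c I d
  rw [weightPiece_of_ne_zero c I hd, weightPiece_of_ne_zero c I he,
    weightPiece_of_ne_zero c I (by omega : d + e ≠ 0), Submodule.span_mul_span, Submodule.span_le]
  rintro _ ⟨_, ⟨i, hi, hdc, rfl⟩, _, ⟨i', hi', hec, rfl⟩, rfl⟩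
  change tpow c i d * tpow c i' e ∈ _
  rcases eq_or_ne i i' with rfl | h
  · rw [tpow_mul_tpow]
    by_cases hs : d + e < c i
    · exact Submodule.subset_span ⟨i, hi, hs, rfl⟩
    · rw [tpow_eq_zero c (not_lt.1 hs)]
      exact zero_mem _
  · rw [tpow_mul_tpow_of_ne c h]
    exact zero_mem _

theorem weightPiece_apply_mem_span {d : ℕ} {x : TruncPi k c} (hx : x ∈ weightPiece k c I d)
    {i : ι} (hi : i ∈ I) : x i ∈ Submodule.span k {truncX k (c i) ^ d} := by
  suffices h : weightPiece k c I d ≤ (Submodule.span k {truncX k (c i) ^ d}).comap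
      (LinearMap.proj i) from h hx
  rcases eq_or_ne d 0 with rfl | hd
  · rw [weightPiece, if_pos rfl, Submodule.span_le]
    rintro _ (rfl | ⟨i', hi', j, -, -, rfl⟩)
    · simp
    · have h : i ≠ i' := by
        rintro rfl
        exact Finset.mem_compl.1 hi' hi
      simp [tpow, h]
  · rw [weightPiece_of_ne_zero c I hd, Submodule.span_le]
    rintro _ ⟨i', hi', -, rfl⟩
    rcases eq_or_ne i i' with rfl | h
    · simp [tpow]
    · simp [tpow, h]

theorem mul_mem_weightPiece (d e : ℕ) (x : TruncPi k c) (hx : x ∈ weightPiece k c I d)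
    (y : TruncPi k c) (hy : y ∈ weightPiece k c I e) : x * y ∈ weightPiece k c I (d + e) :=
  weightPiece_mul_le c I d e (Submodule.mul_mem_mul hx hy)

theorem gradedTail_weightPiece_apply {d : ℕ} {x : TruncPi k c}
    (hx : x ∈ gradedTail (weightPiece k c I) (d + 1)) (i : ι) :
    (i ∈ I → truncX k (c i) ^ (d + 1) ∣ x i) ∧ (i ∉ I → x i = 0) := by
  let W : Submodule k (TruncPi k c) :=
    { carrier := {x | (i ∈ I → truncX k (c i) ^ (d + 1) ∣ x i) ∧ (i ∉ I → x i = 0)}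
      add_mem' := fun ha hb => ⟨fun h => dvd_add (ha.1 h) (hb.1 h), fun h => by
        simp [ha.2 h, hb.2 h]⟩
      zero_mem' := by simp
      smul_mem' := fun r x hx => ⟨fun h => dvd_smul_of_dvd r (hx.1 h), fun h => by
        simp [hx.2 h]⟩ }
  suffices h : gradedTail (weightPiece k c I) (d + 1) ≤ W from h hx
  refine gradedTail_le fun e he => ?_
  rw [weightPiece_of_ne_zero c I (by omega), Submodule.span_le]
  rintro _ ⟨i', hi', -, rfl⟩
  rcases eq_or_ne i i' with rfl | h
  · exact ⟨fun _ => by simpa [tpow] using pow_dvd_pow _ he, fun h => absurd hi' h⟩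
  · exact ⟨fun _ => by simp [tpow, h], fun _ => by simp [tpow, h]⟩

theorem weightPiece_disjoint_gradedTail (d : ℕ) :
    Disjoint (weightPiece k c I d) (gradedTail (weightPiece k c I) (d + 1)) := by
  rw [Submodule.disjoint_def]
  intro x hx hx'
  funext i
  obtain ⟨h1, h2⟩ := gradedTail_weightPiece_apply c I hx' i
  by_cases hi : i ∈ I
  · obtain ⟨r, hr⟩ := Submodule.mem_span_singleton.1 (weightPiece_apply_mem_span c I hx hi)
    obtain ⟨y, hy⟩ := h1 hi
    rw [← hr, smul_truncX_pow_eq_zero (hr.trans hy)]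
    rfl
  · exact h2 hi

theorem weightPiece_eq_bot {d : ℕ} (hd : (∑ i, c i) + 1 ≤ d) : weightPiece k c I d = ⊥ := by
  rw [weightPiece_of_ne_zero c I (by omega), Submodule.span_eq_bot]
  rintro _ ⟨i, -, hdc, -⟩
  have := Finset.single_le_sum (f := c) (fun _ _ => Nat.zero_le _) (Finset.mem_univ i)
  omega

theorem weightPiece_le_Aplus (hc : ∀ i, 1 ≤ c i) (d : ℕ) :
    weightPiece k c I d ≤ Subalgebra.toSubmodule (Aplus k c hc) := by
  rcases eq_or_ne d 0 with rfl | hd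
  · rw [weightPiece, if_pos rfl, Submodule.span_le]
    rintro _ (rfl | ⟨i, -, j, hj, -, rfl⟩)
    · exact one_mem (Aplus k c hc)
    · exact tpow_mem_Aplus c hc i hj
  · rw [weightPiece_of_ne_zero c I hd, Submodule.span_le]
    rintro _ ⟨i, -, -, rfl⟩
    exact tpow_mem_Aplus c hc i (by omega)

theorem Aplus_le_gradedTail_weightPiece (hc : ∀ i, 1 ≤ c i) :
    Subalgebra.toSubmodule (Aplus k c hc) ≤ gradedTail (weightPiece k c I) 0 := by
  have h0 : Submodule.span k {1} ⊔ mPart k c ↑(Iᶜ) ≤ gradedTail (weightPiece k c I) 0 :=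
    (weightPiece_zero c I).ge.trans (le_gradedTail _ le_rfl)
  refine (Aplus_le_span_one_sup_mPart c hc).trans (sup_le (le_sup_left.trans h0) ?_)
  rw [mPart, Submodule.span_le]
  rintro _ ⟨i, -, j, hj, hjc, rfl⟩
  by_cases hi : i ∈ I
  · refine le_gradedTail (weightPiece k c I) j.zero_le ?_
    rw [weightPiece_of_ne_zero c I (by omega)]
    exact Submodule.subset_span ⟨i, hi, hjc, rfl⟩
  · exact (le_sup_right.trans h0)
      (Submodule.subset_span ⟨i, Finset.mem_coe.2 (Finset.mem_compl.2 hi), j, hj, hjc, rfl⟩)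

end OneParameterGrading

/-- grading `A⁺` with `deg tᵢ^j = j` for `i ∈ I` and `deg tᵢ^j = 0` for
`i ∈ I'`, the initial subalgebra `in(B)` (spanned by lowest-degree homogeneous components
of nonzero elements of `B`) is a subalgebra of `A⁺` of the same dimension as `B` which is
decomposable: `in(B) = k·1 ⊕ (in(B) ∩ m_I) ⊕ (in(B) ∩ m_{I'})`, the join of the two
multiplicatively closed subspaces `in(B) ∩ m_I` and `in(B) ∩ m_{I'}`. -/
theorem one_parameter_limit_decomposable
    {k : Type*} [Field k] {m : ℕ} (c : Fin m → ℕ) (hc : ∀ i, 1 ≤ c i)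
    (I : Finset (Fin m)) (hI : I.Nonempty) (hI' : Iᶜ.Nonempty)
    (B : Subalgebra k (TruncPi k c)) (hB : B ≤ Aplus k c hc) :
    let piece : ℕ → Submodule k (TruncPi k c) := fun d =>
      if d = 0 then
        Submodule.span k ({1} ∪ {x | ∃ i ∈ Iᶜ, ∃ j, 1 ≤ j ∧ j < c i ∧ x = tpow c i j})
      else Submodule.span k {x | ∃ i ∈ I, d < c i ∧ x = tpow c i d}
    let Fil : ℕ → Submodule k (TruncPi k c) := fun d => ⨆ e : ℕ, ⨆ _ : d ≤ e, piece e
    let inB : Submodule k (TruncPi k c) := Submodule.span k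
      {x | ∃ b ∈ B, ∃ d : ℕ, x ∈ piece d ∧ x ≠ 0 ∧ b - x ∈ Fil (d + 1)}
    ((1 : TruncPi k c) ∈ inB ∧
      (∀ x ∈ inB, ∀ y ∈ inB, x * y ∈ inB) ∧
      inB ≤ Subalgebra.toSubmodule (Aplus k c hc)) ∧
    Module.finrank k ↥inB = Module.finrank k ↥B ∧
    inB = Submodule.span k {(1 : TruncPi k c)} ⊔ (inB ⊓ mPart k c ↑I)
        ⊔ (inB ⊓ mPart k c ↑(Iᶜ)) ∧
    (∀ x ∈ inB ⊓ mPart k c ↑I, ∀ y ∈ inB ⊓ mPart k c ↑I, x * y ∈ inB ⊓ mPart k c ↑I) ∧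
    (∀ x ∈ inB ⊓ mPart k c ↑(Iᶜ), ∀ y ∈ inB ⊓ mPart k c ↑(Iᶜ),
      x * y ∈ inB ⊓ mPart k c ↑(Iᶜ)) := by
  intro piece Fil inB
  have hin : inB = gradedTail (leadingPiece (weightPiece k c I) (Subalgebra.toSubmodule B)) 0 :=
    span_leading_forms (weightPiece k c I) (Subalgebra.toSubmodule B)
  clear_value inB
  subst hin
  set L := leadingPiece (weightPiece k c I) (Subalgebra.toSubmodule B)
  have hLP : ∀ d, L d ≤ weightPiece k c I d := leadingPiece_le _ _
  have hone : (1 : TruncPi k c) ∈ gradedTail L 0 :=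
    one_mem_gradedTail_leadingPiece (one_mem_weightPiece_zero c I) B
  have hmul : ∀ x ∈ gradedTail L 0, ∀ y ∈ gradedTail L 0, x * y ∈ gradedTail L 0 :=
    fun x hx y hy => mul_mem_gradedTail_leadingPiece (mul_mem_weightPiece c I) B hx hy
  have hjoin : ∀ J : Set (Fin m), ∀ x ∈ gradedTail L 0 ⊓ mPart k c J,
      ∀ y ∈ gradedTail L 0 ⊓ mPart k c J, x * y ∈ gradedTail L 0 ⊓ mPart k c J :=
    fun J x hx y hy => ⟨hmul x hx.1 y hy.1, mul_mem_mPart c hx.2 hy.2⟩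
  have hBtail : Subalgebra.toSubmodule B ≤ gradedTail (weightPiece k c I) 0 :=
    fun b hb => Aplus_le_gradedTail_weightPiece c I hc (hB hb)
  refine ⟨⟨hone, hmul, gradedTail_le fun d _ => (hLP d).trans (weightPiece_le_Aplus c I hc d)⟩,
    ?_, le_antisymm ?_ ?_, hjoin _, hjoin _⟩
  · rw [finrank_gradedTail_leadingPiece (weightPiece_disjoint_gradedTail c I)
      (fun _ => weightPiece_eq_bot c I),
      inf_eq_left.2 hBtail]
    rfl
  · refine gradedTail_le fun d _ x hx => ?_
    have hxL := le_gradedTail L d.zero_le hx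
    rcases eq_or_ne d 0 with rfl | hd
    · have hx0 := hLP 0 hx
      rw [weightPiece_zero] at hx0
      obtain ⟨a, ha, y, hy, rfl⟩ := Submodule.mem_sup.1 hx0
      have haL : a ∈ gradedTail L 0 := (Submodule.span_singleton_le_iff_mem _ _).2 hone ha
      refine add_mem (Submodule.mem_sup_left (Submodule.mem_sup_left ha))
        (Submodule.mem_sup_right ⟨?_, hy⟩)
      simpa using sub_mem hxL haL
    · exact Submodule.mem_sup_left (Submodule.mem_sup_right
        ⟨hxL, weightPiece_le_mPart c I hd (hLP d hx)⟩)
  · exact sup_le (sup_le ((Submodule.span_singleton_le_iff_mem _ _).2 hone) inf_le_left)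
      inf_le_left
end
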